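/- Let L be a Lie algebra over a field of characteristic p > 0 such that the first Chevalley–Eilenberg cohomology H^1_{CE}(L,L) vanishes (every derivation is inner). Then L admits a p-map, i.e. L can be made into a restricted Lie algebra. -/

import Mathlib

/-- The term `s_i(x, y)` appearing in the definition of a `p`-map:
`i·s_i(x,y)` is the coefficient of `Z^{i-1}` in `ad_{Zx+y}^{p-1}(x)`; explicitly
`s_i(x,y) = (i)⁻¹ Σ [x_1,[x_2,[⋯,[x_{p-2},[y,x]]⋯]` where the sum runs over all
choices `x_k ∈ {x,y}` with exactly `i-1` of the `x_k` equal to `x`. -/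
noncomputable def sFormula (F L : Type*) [Field F] [LieRing L] [LieAlgebra F L]
    (p i : ℕ) (x y : L) : L :=
  (i : F)⁻¹ • ∑ w : Fin (p - 2) → Bool,
    if (Finset.univ.filter (fun k => w k)).card = i - 1 then
      (List.ofFn (fun k => if w k then x else y)).foldr (fun a b => ⁅a, b⁆) ⁅y, x⁆
    else 0

/-- A `p`-map on a Lie algebra `L` over a field of characteristic `p`. -/
noncomputable def IsPMap (F L : Type*) [Field F] [LieRing L] [LieAlgebra F L]
    (p : ℕ) (sq : L → L) : Prop :=
  (∀ (c : F) (x : L), sq (c • x) = c ^ p • sq x) ∧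
  (∀ x y : L, ⁅x, sq y⁆ = ((fun z => ⁅z, y⁆)^[p]) x) ∧
  (∀ x y : L, sq (x + y) = sq x + sq y + ∑ i ∈ Finset.Icc 1 (p - 1), sFormula F L p i x y)

section PMapAux

open Finset

attribute [local instance] LieRing.ofAssociativeRing

/-- iterated bracket along a boolean word -/
def lieWord {L : Type*} [LieRing L] {n : ℕ} (w : Fin n → Bool) (x y z : L) : L :=
  (List.ofFn (fun k => if w k then x else y)).foldr (fun a b => ⁅a, b⁆) z

/-- number of `true` letters -/
def wcnt {n : ℕ} (w : Fin n → Bool) : ℕ := (Finset.univ.filter (fun k => w k)).card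

lemma lieWord_cons {L : Type*} [LieRing L] {n : ℕ} (a : Bool) (w : Fin n → Bool) (x y z : L) :
    lieWord (Fin.cons a w : Fin (n+1) → Bool) x y z = ⁅(if a then x else y), lieWord w x y z⁆ := by
  simp [lieWord, List.ofFn_succ]

lemma lieWord_zero {L : Type*} [LieRing L] (w : Fin 0 → Bool) (x y z : L) :
    lieWord w x y z = z := by
  simp [lieWord]

lemma wcnt_cons {n : ℕ} (a : Bool) (w : Fin n → Bool) :
    wcnt (Fin.cons a w : Fin (n+1) → Bool) = (if a then 1 else 0) + wcnt w := by
  unfold wcnt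
  rw [Finset.card_filter, Finset.card_filter, Fin.sum_univ_succ]
  simp only [Fin.cons_zero, Fin.cons_succ]

lemma wcnt_zero (w : Fin 0 → Bool) : wcnt w = 0 := by
  simp [wcnt]

lemma wcnt_le {n : ℕ} (w : Fin n → Bool) : wcnt w ≤ n := by
  simpa [wcnt] using Finset.card_filter_le (Finset.univ : Finset (Fin n)) (fun k => w k = true)

/-- induction principle on words -/
lemma word_induct {P : ∀ n, (Fin n → Bool) → Prop} (h0 : ∀ w, P 0 w)
    (hs : ∀ n a (w : Fin n → Bool), P n w → P (n+1) (Fin.cons a w : Fin (n+1) → Bool)) :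
    ∀ n w, P n w := by
  intro n
  induction n with
  | zero => exact h0
  | succ n ih =>
    intro w
    have := hs n (w 0) (Fin.tail w) (ih _)
    rwa [Fin.cons_self_tail] at this

lemma sum_word_succ {L : Type*} [AddCommMonoid L] {n : ℕ} (f : (Fin (n+1) → Bool) → L) :
    ∑ w, f w = ∑ w : Fin n → Bool, (f (Fin.cons true w : Fin (n+1) → Bool)
      + f (Fin.cons false w : Fin (n+1) → Bool)) := by
  rw [← (Fin.consEquiv (fun _ : Fin (n+1) => Bool)).sum_comp, Fintype.sum_prod_type]
  simp [Fin.consEquiv, Finset.sum_add_distrib]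

lemma sum_lieWord {L : Type*} [LieRing L] (n : ℕ) (x y z : L) :
    ∑ w : Fin n → Bool, lieWord w x y z = (fun b => ⁅x + y, b⁆)^[n] z := by
  induction n with
  | zero => simp [lieWord_zero]
  | succ n ih =>
    rw [sum_word_succ, Function.iterate_succ_apply', ← ih]
    simp only [lieWord_cons, lie_sum, add_lie]
    simp

/-- the sum of the `s_i` -/
noncomputable def jacS (F : Type*) {L : Type*} [Field F] [LieRing L] [LieAlgebra F L]
    (p : ℕ) (x y : L) : L :=
  ∑ w : Fin (p - 2) → Bool, ((wcnt w + 1 : ℕ) : F)⁻¹ • lieWord w x y ⁅y, x⁆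

lemma sum_sFormula (F L : Type*) [Field F] [LieRing L] [LieAlgebra F L]
    (p : ℕ) (hp : 2 ≤ p) (x y : L) :
    ∑ i ∈ Finset.Icc 1 (p - 1), sFormula F L p i x y = jacS F p x y := by
  unfold sFormula jacS
  simp only [Finset.smul_sum]
  rw [Finset.sum_comm]
  refine Finset.sum_congr rfl fun w _ => ?_
  have hw := wcnt_le w
  rw [Finset.sum_eq_single (wcnt w + 1)]
  · rw [if_pos]
    · rfl
    · simp [wcnt]
  · intro b hb hne
    rw [if_neg, smul_zero]
    intro hh
    change wcnt w = b - 1 at hh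
    have := (Finset.mem_Icc.mp hb).1
    omega
  · intro hh
    exfalso
    apply hh
    rw [Finset.mem_Icc]
    omega

lemma lieWord_map {F L M : Type*} [CommRing F] [LieRing L] [LieAlgebra F L] [LieRing M]
    [LieAlgebra F M] (f : L →ₗ⁅F⁆ M) (x y z : L) : ∀ n (w : Fin n → Bool),
    f (lieWord w x y z) = lieWord w (f x) (f y) (f z) := by
  apply word_induct
  · intro w; simp [lieWord_zero]
  · intro n a w ih
    rw [lieWord_cons, lieWord_cons, LieHom.map_lie, ih]
    cases a <;> simp

lemma jacS_map {F L M : Type*} [Field F] [LieRing L] [LieAlgebra F L] [LieRing M]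
    [LieAlgebra F M] (p : ℕ) (f : L →ₗ⁅F⁆ M) (x y : L) :
    f (jacS F p x y) = jacS F p (f x) (f y) := by
  simp [jacS, lieWord_map]

lemma lieWord_smul {F L : Type*} [CommRing F] [LieRing L] [LieAlgebra F L]
    (c : F) (x y z : L) : ∀ n (w : Fin n → Bool),
    lieWord w (c • x) (c • y) z = c ^ n • lieWord w x y z := by
  apply word_induct
  · intro w; simp [lieWord_zero]
  · intro n a w ih
    rw [lieWord_cons, lieWord_cons, ih]
    cases a <;> simp [smul_smul, pow_succ]

lemma lieWord_smul_right {F L : Type*} [CommRing F] [LieRing L] [LieAlgebra F L]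
    (c : F) (x y z : L) : ∀ n (w : Fin n → Bool),
    lieWord w x y (c • z) = c • lieWord w x y z := by
  apply word_induct
  · intro w; simp [lieWord_zero]
  · intro n a w ih
    rw [lieWord_cons, lieWord_cons, ih]
    cases a <;> simp

lemma lieWord_zero_right {L : Type*} [LieRing L] (x y : L) : ∀ n (w : Fin n → Bool),
    lieWord w x y 0 = 0 := by
  apply word_induct
  · intro w; simp [lieWord_zero]
  · intro n a w ih
    rw [lieWord_cons, ih, lie_zero]

lemma jacS_smul {F L : Type*} [Field F] [LieRing L] [LieAlgebra F L]
    (p : ℕ) (hp : 2 ≤ p) (c : F) (x y : L) :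
    jacS F p (c • x) (c • y) = c ^ p • jacS F p x y := by
  simp only [jacS, Finset.smul_sum, lieWord_smul, smul_lie, lie_smul, lieWord_smul_right, smul_smul]
  refine Finset.sum_congr rfl fun w _ => ?_
  congr 1
  obtain ⟨q, rfl⟩ := Nat.exists_eq_add_of_le hp
  simp only [Nat.add_sub_cancel_left]
  ring

lemma jacS_eq_zero {F L : Type*} [Field F] [LieRing L] [LieAlgebra F L]
    (p : ℕ) (x y : L) (h : ⁅y, x⁆ = 0) : jacS F p x y = 0 := by
  simp [jacS, h, lieWord_zero_right]

/-! ### Jacobson's formula in associative algebras -/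

lemma choose_pred_mul {R : Type*} [Ring R] (p : ℕ) [Fact p.Prime] (hp : (p : R) = 0) (m : ℕ)
    (hm : m < p) : ((p - 1).choose m : R) = (-1) ^ m := by
  induction m with
  | zero => simp
  | succ m ih =>
    have h1 : ((p.choose (m+1) : ℕ) : R) = 0 := by
      obtain ⟨k, hk⟩ := (Fact.out : p.Prime).dvd_choose_self (Nat.succ_ne_zero m) hm
      rw [hk]; simp [hp]
    have h2 : p.choose (m+1) = (p-1).choose m + (p-1).choose (m+1) := by
      obtain ⟨q, rfl⟩ : ∃ q, p = q + 1 := ⟨p - 1, by omega⟩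
      simp [Nat.choose_succ_succ]
    rw [h2, Nat.cast_add, ih (by omega)] at h1
    rw [pow_succ, mul_neg_one]
    exact eq_neg_of_add_eq_zero_right h1

lemma sub_pow_pred {R : Type*} [Ring R] (p : ℕ) [Fact p.Prime] (hp : (p : R) = 0) (a b : R)
    (h : Commute a b) : (a - b) ^ (p - 1) = ∑ i ∈ range p, a ^ i * b ^ (p - 1 - i) := by
  have hp2 := (Fact.out : p.Prime).two_le
  rw [sub_eq_add_neg, (h.neg_right).add_pow]
  rw [show p - 1 + 1 = p by omega]
  refine Finset.sum_congr rfl fun i hi => ?_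
  have hi : i < p := Finset.mem_range.mp hi
  have hh : (-1 : R) ^ (p - 1) = 1 := by
    have := choose_pred_mul (R := R) p hp (p-1) (by omega)
    simpa using this.symm
  rw [neg_pow, choose_pred_mul p hp i hi, mul_assoc, ((Commute.neg_one_left _).pow_left _).eq,
    mul_assoc, ← pow_add, show p - 1 - i + i = p - 1 by omega, hh, mul_one]

open Polynomial in
lemma derivative_pow_nc {A : Type*} [Ring A] (u : A[X]) (n : ℕ) :
    derivative (u ^ n) = ∑ i ∈ range n, u ^ i * derivative u * u ^ (n - 1 - i) := by
  induction n with
  | zero => simp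
  | succ n ih =>
    rw [pow_succ, derivative_mul, ih, Finset.sum_range_succ, Finset.sum_mul]
    simp only [Nat.add_sub_cancel, Nat.sub_self, pow_zero, mul_one]
    congr 1
    refine Finset.sum_congr rfl fun i hi => ?_
    have := Finset.mem_range.mp hi
    rw [mul_assoc, ← pow_succ, show n - 1 - i + 1 = n - i by omega]

lemma ad_pow_pred {A : Type*} [Ring A] (p : ℕ) [Fact p.Prime] (hp : (p : A) = 0) (u v : A) :
    (fun b => ⁅u, b⁆)^[p - 1] v = ∑ i ∈ range p, u ^ i * v * u ^ (p - 1 - i) := by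
  have h := sub_pow_pred (R := Module.End ℤ A) p (by
    ext a; simp [hp]) (LinearMap.mulLeft ℤ u) (LinearMap.mulRight ℤ u)
    (LinearMap.commute_mulLeft_right u u)
  have h2 := congrArg (fun f => f v) h
  simp only [LinearMap.pow_mulLeft, LinearMap.pow_mulRight, Module.End.pow_apply] at h2
  simp only [LinearMap.sum_apply, Module.End.mul_apply, LinearMap.mulLeft_apply,
    LinearMap.mulRight_apply, ← mul_assoc] at h2
  rw [← h2]
  rfl

open Polynomial in
lemma lieWord_poly {A : Type*} [Ring A] (x y z : A) : ∀ n (w : Fin n → Bool),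
    lieWord w (C x * X) (C y) (C z) = C (lieWord w x y z) * X ^ (wcnt w) := by
  apply word_induct
  · intro w; simp [lieWord_zero, wcnt_zero]
  · intro n a w ih
    rw [lieWord_cons, lieWord_cons, ih, wcnt_cons]
    cases a
    · simp only [Bool.false_eq_true, if_false, zero_add, LieRing.of_associative_ring_bracket,
        map_sub, map_mul, sub_mul]
      simp only [mul_assoc, X_pow_mul_C]
    · simp only [if_true, LieRing.of_associative_ring_bracket, C_mul_X_eq_monomial,
        C_mul_X_pow_eq_monomial, monomial_mul_monomial, add_comm (wcnt w) 1, map_sub,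
        sub_mul]

open Polynomial in
lemma jacobson_assoc (F : Type*) {A : Type*} [Field F] [Ring A] [Algebra F A] (p : ℕ)
    [Fact p.Prime] [CharP F p] (x y : A) :
    (x + y) ^ p = x ^ p + y ^ p + jacS F p x y := by
  have hp2 := (Fact.out : p.Prime).two_le
  have hpA : (p : A) = 0 := by
    rw [← map_natCast (algebraMap F A), CharP.cast_eq_zero, map_zero]
  have hpAX : (p : A[X]) = 0 := by
    rw [← C_eq_natCast, hpA, C_0]
  set u : A[X] := C x * X + C y with hu
  set Q : A[X] := ∑ w : Fin (p - 2) → Bool,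
    C (((wcnt w + 1 : ℕ) : F)⁻¹ • lieWord w x y ⁅y, x⁆) * X ^ (wcnt w + 1) with hQ
  have hder : derivative (u ^ p) = derivative Q := by
    rw [derivative_pow_nc]
    have : derivative u = C x := by simp [hu]
    rw [this, ← ad_pow_pred p hpAX, show p - 1 = (p - 2) + 1 by omega, Function.iterate_succ_apply]
    have h1 : ⁅u, C x⁆ = C ⁅y, x⁆ := by
      simp only [hu, LieRing.of_associative_ring_bracket, add_mul, mul_add, map_sub, map_mul]
      rw [mul_assoc (C x), X_mul_C]
      abel
    rw [h1, hu, ← sum_lieWord, hQ, derivative_sum]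
    refine Finset.sum_congr rfl fun w _ => ?_
    rw [lieWord_poly, derivative_C_mul_X_pow]
    simp only [Nat.add_sub_cancel]
    congr 2
    have hw := wcnt_le w
    have hne : ((wcnt w + 1 : ℕ) : F) ≠ 0 := by
      intro h0
      rw [CharP.cast_eq_zero_iff F p] at h0
      exact absurd (Nat.le_of_dvd (by omega) h0) (by omega)
    rw [← nsmul_eq_mul', ← Nat.cast_smul_eq_nsmul F, smul_smul, mul_inv_cancel₀ hne, one_smul]
  have hdegu : natDegree u ≤ 1 := natDegree_linear_le
  have hmain : u ^ p = C (x ^ p) * X ^ p + C (y ^ p) + Q := by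
    ext n
    have hQc : Q.coeff n = 0 ∨ (1 ≤ n ∧ n < p) := by
      by_cases hn : 1 ≤ n ∧ n < p
      · exact Or.inr hn
      · left
        rw [hQ, finsetSum_coeff]
        refine Finset.sum_eq_zero fun w _ => ?_
        have hw := wcnt_le w
        rw [coeff_C_mul_X_pow, if_neg (by omega)]
    by_cases hn : 1 ≤ n ∧ n < p
    · have hc := congrArg (fun f => coeff f (n - 1)) hder
      simp only [coeff_derivative] at hc
      rw [show n - 1 + 1 = n by omega] at hc
      have hne : ((n : ℕ) : F) ≠ 0 := by
        intro h0
        rw [CharP.cast_eq_zero_iff F p] at h0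
        exact absurd (Nat.le_of_dvd (by omega) h0) (by omega)
      have e : ((n - 1 : ℕ) : A) + 1 = (n : A) := by
        rw [← Nat.cast_succ]; congr 1; omega
      rw [e, ← nsmul_eq_mul', ← nsmul_eq_mul', ← Nat.cast_smul_eq_nsmul F,
        ← Nat.cast_smul_eq_nsmul F] at hc
      have hc' := smul_right_injective A hne hc
      rw [hc']
      simp only [coeff_add, coeff_C_mul_X_pow, coeff_C]
      rw [if_neg (by omega), if_neg (by omega)]
      simp
    · have hQ0 : Q.coeff n = 0 := hQc.resolve_right hn
      simp only [coeff_add, coeff_C_mul_X_pow, coeff_C, hQ0]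
      rcases Nat.eq_zero_or_pos n with h0 | h0
      · subst h0
        rw [if_neg (by omega), if_pos rfl, ← constantCoeff_apply, map_pow]
        simp [hu]
      · rw [if_neg (show n ≠ 0 by omega)]
        rcases Nat.lt_or_ge p n with h1 | h1
        · rw [if_neg (by omega), coeff_eq_zero_of_natDegree_lt]
          · simp
          · calc _ ≤ p * natDegree u := natDegree_pow_le
              _ ≤ p * 1 := by gcongr
              _ < n := by omega
        · have : n = p := by omega
          subst this
          have := coeff_pow_of_natDegree_le (m := n) hdegu
          rw [mul_one] at this
          rw [if_pos rfl, this]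
          simp [hu]
  set φ : A[X] →+* A := eval₂RingHom' (RingHom.id A) 1 (fun a => Commute.one_right _) with hφ
  have hC : ∀ a, φ (C a) = a := fun a => by simp [hφ, eval₂RingHom']
  have hX : φ X = 1 := by simp [hφ, eval₂RingHom']
  have hev := congrArg φ hmain
  rw [map_pow, hu, hQ] at hev
  simp only [map_add, map_mul, hC, hX, map_sum, map_pow φ X, one_pow, mul_one] at hev
  exact hev

lemma ad_jacS {F N : Type*} [Field F] [LieRing N] [LieAlgebra F N] (p : ℕ)
    [Fact p.Prime] [CharP F p] (x y : N) :
    LieAlgebra.ad F N (jacS F p x y) =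
      (LieAlgebra.ad F N (x + y)) ^ p - (LieAlgebra.ad F N x) ^ p - (LieAlgebra.ad F N y) ^ p := by
  rw [jacS_map, map_add, jacobson_assoc F p]
  abel

open LieAlgebra SemiDirectSum in
lemma ad_pow_inl {F M : Type*} [Field F] [LieRing M] [LieAlgebra F M]
    (D : LieDerivation F M M) (x : M) (n : ℕ) :
    ((ad F (M ⋊⁅(LieHom.id : LieDerivation F M M →ₗ⁅F⁆ LieDerivation F M M)⁆ (LieDerivation F M M))
      (inl _ x)) ^ (n + 1)) (inr _ D) = inl _ (- ((ad F M x) ^ n) (D x)) := by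
  induction n with
  | zero => simp
  | succ n ih =>
    rw [pow_succ', Module.End.mul_apply, ih, ad_apply, ← LieHom.map_lie, pow_succ' _ n,
      Module.End.mul_apply, ad_apply, lie_neg]

open LieAlgebra SemiDirectSum in
lemma deriv_jacS {F M : Type*} [Field F] [LieRing M] [LieAlgebra F M] (p : ℕ)
    [Fact p.Prime] [CharP F p] (D : LieDerivation F M M) (x y : M) :
    D (jacS F p x y) = ((ad F M (x + y)) ^ (p - 1)) (D (x + y))
      - ((ad F M x) ^ (p - 1)) (D x) - ((ad F M y) ^ (p - 1)) (D y) := by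
  have hp2 := (Fact.out : p.Prime).two_le
  set ψ : LieDerivation F M M →ₗ⁅F⁆ LieDerivation F M M := LieHom.id with hψ
  have h := congrArg (fun f => f (inr ψ D)) (ad_jacS (F := F) p (inl ψ x) (inl ψ y))
  simp only [LinearMap.sub_apply] at h
  rw [← map_add, ← jacS_map] at h
  have e : p = (p - 1) + 1 := by omega
  have h1 := fun z => ad_pow_inl D z (p - 1)
  rw [← e] at h1
  have h0 := ad_pow_inl D (jacS F p x y) 0
  rw [zero_add, pow_one, pow_zero] at h0
  rw [h0, h1, h1, h1, ← map_sub, ← map_sub] at h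
  have h := inl_injective ψ h
  simp only [Module.End.one_apply] at h
  rw [← neg_inj, h]
  abel

lemma deriv_comm_defect {F M : Type*} [Field F] [LieRing M] [LieAlgebra F M] (p : ℕ)
    [Fact p.Prime] [CharP F p] (D : LieDerivation F M M) (u v : M) :
    D (jacS F p u v - jacS F p v u) = 0 := by
  rw [map_sub, deriv_jacS, deriv_jacS, add_comm v u]
  abel

lemma deriv_cocycle_defect {F M : Type*} [Field F] [LieRing M] [LieAlgebra F M] (p : ℕ)
    [Fact p.Prime] [CharP F p] (D : LieDerivation F M M) (u v t : M) :
    D (jacS F p u v + jacS F p (u + v) t - jacS F p v t - jacS F p u (v + t)) = 0 := by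
  rw [map_sub, map_sub, map_add, deriv_jacS, deriv_jacS, deriv_jacS, deriv_jacS, add_assoc u v t]
  abel

open scoped TensorProduct Polynomial

section polyLie

variable {F L : Type*} [Field F] [LieRing L] [LieAlgebra F L]

/-- the Lie algebra `L[t]` -/
def PolyLie (F L : Type*) [Field F] [LieRing L] [LieAlgebra F L] : Type _ := F[X] ⊗[F] L

noncomputable instance : LieRing (PolyLie F L) := inferInstanceAs (LieRing (F[X] ⊗[F] L))

noncomputable instance : LieAlgebra F (PolyLie F L) :=
  inferInstanceAs (LieAlgebra F (F[X] ⊗[F] L))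

/-- pure tensors -/
noncomputable def pmk (f : F[X]) (l : L) : PolyLie F L := f ⊗ₜ[F] l

lemma pmk_lie (f g : F[X]) (l m : L) : ⁅pmk f l, pmk g m⁆ = pmk (f * g) ⁅l, m⁆ := rfl

lemma pmk_zero (f : F[X]) : pmk f (0 : L) = 0 := TensorProduct.tmul_zero _ _

lemma pmk_add (f : F[X]) (l m : L) : pmk f (l + m) = pmk f l + pmk f m :=
  TensorProduct.tmul_add _ _ _

lemma pmk_neg (f : F[X]) (l : L) : pmk f (-l) = - pmk f l :=
  TensorProduct.tmul_neg _ _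

lemma pmk_add_left (f g : F[X]) (l : L) : pmk (f + g) l = pmk f l + pmk g l :=
  TensorProduct.add_tmul _ _ _

lemma pmk_smul (c : F) (f : F[X]) (l : L) : pmk f (c • l) = c • pmk f l :=
  TensorProduct.tmul_smul _ _ _

lemma poly_induct {P : PolyLie F L → Prop} (h0 : P 0) (h1 : ∀ f l, P (pmk f l))
    (h2 : ∀ a b, P a → P b → P (a + b)) (u : PolyLie F L) : P u :=
  TensorProduct.induction_on u h0 h1 h2

/-- formal derivative, linear version -/
noncomputable def tDerL (F L : Type*) [Field F] [LieRing L] [LieAlgebra F L] :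
    PolyLie F L →ₗ[F] PolyLie F L :=
  (LinearMap.rTensor L (Polynomial.derivative (R := F)) : F[X] ⊗[F] L →ₗ[F] F[X] ⊗[F] L)

lemma tDerL_pmk (f : F[X]) (l : L) :
    tDerL F L (pmk f l) = pmk (Polynomial.derivative f) l := rfl

lemma tDer_leibniz (a b : PolyLie F L) :
    tDerL F L ⁅a, b⁆ = ⁅a, tDerL F L b⁆ - ⁅b, tDerL F L a⁆ := by
  induction a using poly_induct with
  | h0 => simp
  | h2 a1 a2 h1 h2 =>
    simp only [add_lie, map_add, lie_add, h1, h2]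
    abel
  | h1 f l =>
    induction b using poly_induct with
    | h0 => simp
    | h2 a1 a2 h1 h2 =>
      simp only [add_lie, map_add, lie_add, h1, h2]
      abel
    | h1 g m =>
      simp only [pmk_lie, tDerL_pmk, Polynomial.derivative_mul]
      rw [← lie_skew m l, pmk_neg, sub_neg_eq_add, ← pmk_add_left]
      congr 1
      ring

/-- formal derivative -/
noncomputable def tDer (F L : Type*) [Field F] [LieRing L] [LieAlgebra F L] :
    LieDerivation F (PolyLie F L) (PolyLie F L) where
  toLinearMap := tDerL F L
  leibniz' := tDer_leibniz

lemma tDer_pmk (f : F[X]) (l : L) :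
    tDer F L (pmk f l) = pmk (Polynomial.derivative f) l := rfl

/-- coefficient -/
noncomputable def tCoeff (F L : Type*) [Field F] [LieRing L] [LieAlgebra F L] (n : ℕ) :
    PolyLie F L →ₗ[F] L :=
  ((TensorProduct.lid F L).toLinearMap ∘ₗ LinearMap.rTensor L (Polynomial.lcoeff F n) :
    F[X] ⊗[F] L →ₗ[F] L)

lemma tCoeff_pmk (n : ℕ) (f : F[X]) (l : L) :
    tCoeff F L n (pmk f l) = f.coeff n • l := rfl

/-- evaluation, linear version -/
noncomputable def tEvalL (F L : Type*) [Field F] [LieRing L] [LieAlgebra F L] (a : F) :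
    PolyLie F L →ₗ[F] L :=
  ((TensorProduct.lid F L).toLinearMap ∘ₗ
    LinearMap.rTensor L (Polynomial.aeval a : F[X] →ₐ[F] F).toLinearMap : F[X] ⊗[F] L →ₗ[F] L)

lemma tEvalL_pmk (a : F) (f : F[X]) (l : L) :
    tEvalL F L a (pmk f l) = f.eval a • l := rfl

lemma tCoeff_tDer (n : ℕ) (f : PolyLie F L) :
    tCoeff F L n (tDer F L f) = ((n + 1 : ℕ) : F) • tCoeff F L (n + 1) f := by
  induction f using poly_induct with
  | h0 => simp
  | h2 a1 a2 h1 h2 => simp only [map_add, h1, h2, smul_add]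
  | h1 g m =>
    rw [tDer_pmk, tCoeff_pmk, tCoeff_pmk, Polynomial.coeff_derivative, smul_smul, mul_comm]
    push_cast
    rfl

/-- evaluation -/
noncomputable def tEval (F L : Type*) [Field F] [LieRing L] [LieAlgebra F L] (a : F) :
    PolyLie F L →ₗ⁅F⁆ L where
  toLinearMap := tEvalL F L a
  map_lie' := by
    intro x y
    simp only [AddHom.toFun_eq_coe, LinearMap.coe_toAddHom]
    induction x using poly_induct with
    | h0 => simp
    | h2 a1 a2 h1 h2 => rw [add_lie, map_add, h1, h2, map_add, add_lie]
    | h1 f l =>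
      induction y using poly_induct with
      | h0 => simp
      | h2 a1 a2 h1 h2 => rw [lie_add, map_add, h1, h2, map_add, lie_add]
      | h1 g m =>
        rw [pmk_lie]
        simp [tEvalL_pmk, smul_smul, mul_comm]

lemma tEval_pmk (a : F) (f : F[X]) (l : L) :
    tEval F L a (pmk f l) = f.eval a • l := rfl

/-- degree filtration -/
noncomputable def tFil (F L : Type*) [Field F] [LieRing L] [LieAlgebra F L] (n : ℕ) :
    Submodule F (PolyLie F L) :=
  Submodule.span F {u | ∃ (i : ℕ) (l : L), i ≤ n ∧ u = pmk (Polynomial.X ^ i : F[X]) l}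

lemma tFil_mono {m n : ℕ} (h : m ≤ n) : tFil F L m ≤ tFil F L n := by
  apply Submodule.span_mono
  rintro u ⟨i, l, hi, rfl⟩
  exact ⟨i, l, hi.trans h, rfl⟩

lemma tFil_lie {m n : ℕ} {u v : PolyLie F L} (hu : u ∈ tFil F L m) (hv : v ∈ tFil F L n) :
    ⁅u, v⁆ ∈ tFil F L (m + n) := by
  unfold tFil at hu hv
  induction hu using Submodule.span_induction with
  | zero => simp
  | add x y _ _ h1 h2 => rw [add_lie]; exact add_mem h1 h2
  | smul a x _ h => rw [smul_lie]; exact Submodule.smul_mem _ _ h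
  | mem x hx =>
    obtain ⟨i, l, hi, rfl⟩ := hx
    induction hv using Submodule.span_induction with
    | zero => simp
    | add x y _ _ h1 h2 => rw [lie_add]; exact add_mem h1 h2
    | smul a x _ h => rw [lie_smul]; exact Submodule.smul_mem _ _ h
    | mem x hx =>
      obtain ⟨j, k, hj, rfl⟩ := hx
      refine Submodule.subset_span ⟨i + j, ⁅l, k⁆, by omega, ?_⟩
      rw [pmk_lie, pow_add]

lemma tFil_lie01 {u v : PolyLie F L} (hu : u ∈ tFil F L 0) (hv : v ∈ tFil F L 1) :
    ⁅u, v⁆ ∈ tFil F L 1 := by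
  have h := tFil_lie hu hv
  rwa [zero_add] at h

lemma tFil_lie10 {u v : PolyLie F L} (hu : u ∈ tFil F L 1) (hv : v ∈ tFil F L 0) :
    ⁅u, v⁆ ∈ tFil F L 1 := by
  have h := tFil_lie hu hv
  rwa [add_zero] at h

lemma tFil_lieWord {u v z : PolyLie F L} {k : ℕ} (hu : u ∈ tFil F L 1) (hv : v ∈ tFil F L 1)
    (hz : z ∈ tFil F L k) : ∀ n (w : Fin n → Bool), lieWord w u v z ∈ tFil F L (n + k) := by
  apply word_induct
  · intro w; simpa [lieWord_zero] using hz
  · intro n a w ih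
    rw [lieWord_cons, show n + 1 + k = 1 + (n + k) by omega]
    apply tFil_lie _ ih
    cases a <;> simp [hu, hv]

lemma tFil_jacS {u v : PolyLie F L} (p : ℕ) (hp : 2 ≤ p) (hu : u ∈ tFil F L 1)
    (hv : v ∈ tFil F L 1) (hz : ⁅v, u⁆ ∈ tFil F L 1) : jacS F p u v ∈ tFil F L (p - 1) := by
  unfold jacS
  refine sum_mem fun w _ => Submodule.smul_mem _ _ ?_
  have := tFil_lieWord hu hv hz _ w
  rwa [show p - 2 + 1 = p - 1 by omega] at this

lemma tFil_expand {n : ℕ} {u : PolyLie F L} (hu : u ∈ tFil F L n) :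
    u = ∑ i ∈ range (n + 1), pmk (Polynomial.X ^ i : F[X]) (tCoeff F L i u) := by
  unfold tFil at hu
  induction hu using Submodule.span_induction with
  | zero => simp [pmk_zero]
  | add x y _ _ h1 h2 =>
    simp only [map_add, pmk_add, Finset.sum_add_distrib]
    rw [← h1, ← h2]
  | smul a x _ h =>
    simp only [map_smul, pmk_smul, ← Finset.smul_sum]
    rw [← h]
  | mem x hx =>
    obtain ⟨i, l, hi, rfl⟩ := hx
    rw [Finset.sum_eq_single i]
    · simp [tCoeff_pmk]
    · intro b _ hb
      simp [tCoeff_pmk, Polynomial.coeff_X_pow, hb, pmk_zero]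
    · intro h
      simp at h
      omega

lemma tEval_const (p : ℕ) [Fact p.Prime] [CharP F p] {u : PolyLie F L}
    (hu : u ∈ tFil F L (p - 1)) (hD : tDer F L u = 0) (a b : F) :
    tEval F L a u = tEval F L b u := by
  have hp2 := (Fact.out : p.Prime).two_le
  have h : u = pmk (1 : F[X]) (tCoeff F L 0 u) := by
    have h := tFil_expand hu
    rw [show p - 1 + 1 = p by omega, Finset.sum_eq_single 0] at h
    · simpa using h
    · intro n hn hn0
      have hn := Finset.mem_range.mp hn
      have h1 := tCoeff_tDer (n - 1) u
      rw [hD, map_zero, show n - 1 + 1 = n by omega] at h1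
      have hne : ((n : ℕ) : F) ≠ 0 := by
        intro h0
        rw [CharP.cast_eq_zero_iff F p] at h0
        exact absurd (Nat.le_of_dvd (by omega) h0) (by omega)
      rw [(smul_eq_zero.mp h1.symm).resolve_left hne, pmk_zero]
    · simp
      omega
  rw [h, tEval_pmk, tEval_pmk]
  simp

lemma tFil_C (l : L) : pmk (1 : F[X]) l ∈ tFil F L 0 :=
  Submodule.subset_span ⟨0, l, le_rfl, by simp⟩

lemma tFil_X (l : L) : pmk (Polynomial.X : F[X]) l ∈ tFil F L 1 :=
  Submodule.subset_span ⟨1, l, le_rfl, by simp⟩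

lemma jacS_comm (p : ℕ) [Fact p.Prime] [CharP F p] (x y : L) :
    jacS F p x y = jacS F p y x := by
  have hp2 := (Fact.out : p.Prime).two_le
  obtain ⟨u, hu⟩ : ∃ u : PolyLie F L, u = pmk (Polynomial.X : F[X]) x := ⟨_, rfl⟩
  obtain ⟨v, hv⟩ : ∃ v : PolyLie F L, v = pmk (1 : F[X]) y := ⟨_, rfl⟩
  have hu1 : u ∈ tFil F L 1 := by
    subst_vars
    exact tFil_X x
  have hv0 : v ∈ tFil F L 0 := by
    subst_vars
    exact tFil_C y
  have hv1 : v ∈ tFil F L 1 := tFil_mono (by omega) hv0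
  have hf : jacS F p u v - jacS F p v u ∈ tFil F L (p - 1) :=
    sub_mem (tFil_jacS p hp2 hu1 hv1 (tFil_lie01 hv0 hu1)) (tFil_jacS p hp2 hv1 hu1 (tFil_lie10 hu1 hv0))
  have hD : tDer F L (jacS F p u v - jacS F p v u) = 0 := deriv_comm_defect p _ u v
  have h := tEval_const p hf hD 1 0
  simp only [map_sub, jacS_map, hu, hv, tEval_pmk] at h
  simp only [Polynomial.eval_X, Polynomial.eval_one, one_smul, zero_smul] at h
  rw [jacS_eq_zero p 0 y (by simp), jacS_eq_zero p y 0 (by simp), sub_zero] at h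
  exact sub_eq_zero.mp h

lemma jacS_cocycle (p : ℕ) [Fact p.Prime] [CharP F p] (x y z : L) :
    jacS F p x y + jacS F p (x + y) z = jacS F p y z + jacS F p x (y + z) := by
  have hp2 := (Fact.out : p.Prime).two_le
  obtain ⟨u, hu⟩ : ∃ u : PolyLie F L, u = pmk (Polynomial.X : F[X]) x := ⟨_, rfl⟩
  obtain ⟨v, hv⟩ : ∃ v : PolyLie F L, v = pmk (1 : F[X]) y := ⟨_, rfl⟩
  obtain ⟨t, ht⟩ : ∃ t : PolyLie F L, t = pmk (1 : F[X]) z := ⟨_, rfl⟩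
  have hu1 : u ∈ tFil F L 1 := by
    subst_vars
    exact tFil_X x
  have hv0 : v ∈ tFil F L 0 := by
    subst_vars
    exact tFil_C y
  have ht0 : t ∈ tFil F L 0 := by
    subst_vars
    exact tFil_C z
  have key : ∀ a b, a ∈ tFil F L 1 → b ∈ tFil F L 0 → jacS F p a b ∈ tFil F L (p - 1) :=
    fun a b ha hb => tFil_jacS p hp2 ha (tFil_mono (by omega) hb) (tFil_lie01 hb ha)
  have hv1 : v ∈ tFil F L 1 := tFil_mono (by omega) hv0
  have hf : jacS F p u v + jacS F p (u + v) t - jacS F p v t - jacS F p u (v + t)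
      ∈ tFil F L (p - 1) :=
    sub_mem (sub_mem (add_mem (key _ _ hu1 hv0) (key _ _ (add_mem hu1 hv1) ht0))
      (key _ _ hv1 ht0)) (key _ _ hu1 (add_mem hv0 ht0))
  have hD : tDer F L (jacS F p u v + jacS F p (u + v) t - jacS F p v t - jacS F p u (v + t))
      = 0 := deriv_cocycle_defect p _ u v t
  have h := tEval_const p hf hD 1 0
  simp only [map_sub, map_add, jacS_map, hu, hv, ht, tEval_pmk] at h
  simp only [Polynomial.eval_X, Polynomial.eval_one, one_smul, zero_smul] at h
  rw [jacS_eq_zero p 0 y (by simp), jacS_eq_zero p 0 (y + z) (by simp), zero_add, zero_add,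
    sub_zero, sub_self, sub_sub, sub_eq_zero] at h
  exact h

end polyLie

/-! ### The twisted vector space -/

/-- pairs `(a, x)` to be thought of as `x` with a candidate for its `p`-th power -/
@[ext] structure PExt (F L : Type*) (p : ℕ) where
  /-- candidate `p`-th power -/
  a : L
  /-- base point -/
  x : L

section pext

variable {F L : Type*} {p : ℕ} [Field F] [LieRing L] [LieAlgebra F L] [Fact p.Prime] [CharP F p]

noncomputable instance : Add (PExt F L p) := ⟨fun u v => ⟨u.a + v.a + jacS F p u.x v.x, u.x + v.x⟩⟩
instance : Zero (PExt F L p) := ⟨⟨0, 0⟩⟩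
instance : Neg (PExt F L p) := ⟨fun u => ⟨-u.a, -u.x⟩⟩
instance : SMul F (PExt F L p) := ⟨fun c u => ⟨c ^ p • u.a, c • u.x⟩⟩

lemma pext_add_a (u v : PExt F L p) : (u + v).a = u.a + v.a + jacS F p u.x v.x := rfl
lemma pext_add_x (u v : PExt F L p) : (u + v).x = u.x + v.x := rfl
lemma pext_zero_a : (0 : PExt F L p).a = 0 := rfl
lemma pext_zero_x : (0 : PExt F L p).x = 0 := rfl
lemma pext_neg_a (u : PExt F L p) : (-u).a = -u.a := rfl
lemma pext_neg_x (u : PExt F L p) : (-u).x = -u.x := rfl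
lemma pext_smul_a (c : F) (u : PExt F L p) : (c • u).a = c ^ p • u.a := rfl
lemma pext_smul_x (c : F) (u : PExt F L p) : (c • u).x = c • u.x := rfl

noncomputable instance : AddCommGroup (PExt F L p) where
  add_assoc u v w := by
    ext
    · simp only [pext_add_a, pext_add_x]
      have h := jacS_cocycle (F := F) p u.x v.x w.x
      have e : u.a + v.a + jacS F p u.x v.x + w.a + jacS F p (u.x + v.x) w.x =
        u.a + v.a + w.a + (jacS F p u.x v.x + jacS F p (u.x + v.x) w.x) := by abel
      rw [e, h]
      abel
    · simp only [pext_add_x, add_assoc]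
  zero_add u := by
    ext
    · simp [pext_add_a, pext_zero_a, pext_zero_x, jacS_eq_zero]
    · simp [pext_add_x, pext_zero_x]
  add_zero u := by
    ext
    · simp [pext_add_a, pext_zero_a, pext_zero_x, jacS_eq_zero]
    · simp [pext_add_x, pext_zero_x]
  neg_add_cancel u := by
    ext
    · simp [pext_add_a, pext_zero_a, pext_neg_a, pext_neg_x, jacS_eq_zero]
    · simp [pext_add_x, pext_zero_x, pext_neg_x]
  add_comm u v := by
    ext
    · simp only [pext_add_a]
      rw [jacS_comm, add_comm u.a v.a]
    · simp only [pext_add_x, add_comm]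
  nsmul := nsmulRec
  zsmul := zsmulRec

noncomputable instance : Module F (PExt F L p) where
  one_smul u := by
    ext
    · simp [pext_smul_a]
    · simp [pext_smul_x]
  mul_smul c d u := by
    ext
    · simp [pext_smul_a, mul_pow, mul_smul]
    · simp [pext_smul_x, mul_smul]
  smul_zero c := by
    ext
    · simp [pext_smul_a, pext_zero_a]
    · simp [pext_smul_x, pext_zero_x]
  smul_add c u v := by
    ext
    · simp only [pext_smul_a, pext_add_a, pext_smul_x, smul_add]
      rw [jacS_smul p (Fact.out : p.Prime).two_le]
    · simp [pext_smul_x, pext_add_x]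
  add_smul c d u := by
    ext
    · simp only [pext_smul_a, pext_add_a, pext_smul_x]
      rw [jacS_eq_zero p (c • u.x) (d • u.x) (by simp), add_pow_char, add_smul, add_zero]
    · simp [pext_smul_x, pext_add_x, add_smul]
  zero_smul u := by
    ext
    · simp [pext_smul_a, pext_zero_a, (Fact.out : p.Prime).ne_zero]
    · simp [pext_smul_x, pext_zero_x]

/-- pairs with `ad a = (ad x)^p` -/
noncomputable def pextSub (F L : Type*) (p : ℕ) [Field F] [LieRing L] [LieAlgebra F L]
    [Fact p.Prime] [CharP F p] : Submodule F (PExt F L p) where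
  carrier := {u | LieAlgebra.ad F L u.a = (LieAlgebra.ad F L u.x) ^ p}
  zero_mem' := by
    simp [pext_zero_a, pext_zero_x, (Fact.out : p.Prime).ne_zero]
  add_mem' := by
    intro u v hu hv
    simp only [Set.mem_ofPred_eq] at hu hv ⊢
    rw [pext_add_a, pext_add_x, map_add, map_add, hu, hv, ad_jacS]
    abel
  smul_mem' := by
    intro c u hu
    simp only [Set.mem_ofPred_eq] at hu ⊢
    rw [pext_smul_a, pext_smul_x, map_smul, map_smul, hu, smul_pow]

/-- projection to the base -/
noncomputable def pextProj (F L : Type*) (p : ℕ) [Field F] [LieRing L] [LieAlgebra F L]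
    [Fact p.Prime] [CharP F p] : pextSub F L p →ₗ[F] L where
  toFun u := u.1.x
  map_add' _ _ := rfl
  map_smul' _ _ := rfl

end pext

lemma ad_pow_char_leibniz {F L : Type*} (p : ℕ) [Field F] [LieRing L] [LieAlgebra F L]
    [Fact p.Prime] [CharP F p] (x a b : L) :
    ((LieAlgebra.ad F L x) ^ p) ⁅a, b⁆ =
      ⁅a, ((LieAlgebra.ad F L x) ^ p) b⁆ - ⁅b, ((LieAlgebra.ad F L x) ^ p) a⁆ := by
  have hp2 := (Fact.out : p.Prime).two_le
  have hpL : ∀ z : L, p • z = 0 := fun z => by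
    rw [← Nat.cast_smul_eq_nsmul F, CharP.cast_eq_zero, zero_smul]
  rw [LieAlgebra.ad_pow_lie, ← lie_skew b, sub_neg_eq_add, Finset.Nat.sum_antidiagonal_eq_sum_range_succ_mk,
    Finset.sum_range_succ, ← Nat.succ_pred_eq_of_pos (show 0 < p by omega),
    Finset.sum_range_succ', Nat.succ_pred_eq_of_pos (show 0 < p by omega)]
  rw [Finset.sum_eq_zero]
  · simp
  · intro i hi
    have hi := Finset.mem_range.mp hi
    rw [Nat.pred_eq_sub_one] at hi
    obtain ⟨k, hk⟩ := (Fact.out : p.Prime).dvd_choose_self (Nat.succ_ne_zero i)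
      (show i + 1 < p by omega)
    simp only
    rw [hk, mul_smul, hpL]

end PMapAux

/-- A Lie algebra over a field of characteristic `p > 0` with
`H¹_CE(L,L) = 0` (every derivation is inner) admits a `p`-map. -/
theorem exists_pMap_of_first_cohomology_trivial (F L : Type*) (p : ℕ) [Field F]
    [Fact p.Prime] [CharP F p] [LieRing L] [LieAlgebra F L] [FiniteDimensional F L]
    (h : ∀ D : LieDerivation F L L, ∃ x : L, ∀ y : L, D y = ⁅x, y⁆) :
    ∃ sq : L → L, IsPMap F L p sq := by
  have hp2 := (Fact.out : p.Prime).two_le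
  have hsurj : Function.Surjective (pextProj F L p) := by
    intro x
    obtain ⟨a, ha⟩ := h ⟨(LieAlgebra.ad F L x) ^ p, fun a b => ad_pow_char_leibniz p x a b⟩
    refine ⟨⟨⟨a, x⟩, ?_⟩, rfl⟩
    change LieAlgebra.ad F L a = (LieAlgebra.ad F L x) ^ p
    ext y
    exact (ha y).symm
  obtain ⟨g, hg⟩ := (pextProj F L p).exists_rightInverse_of_surjective
    (LinearMap.range_eq_top.mpr hsurj)
  have hgx : ∀ x, (g x).1.x = x := fun x => congrArg (fun f => f x) hg
  refine ⟨fun x => (g x).1.a, ?_, ?_, ?_⟩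
  · intro c x
    simp only [map_smul]
    rfl
  · intro x y
    have h1 : LieAlgebra.ad F L (g y).1.a = (LieAlgebra.ad F L (g y).1.x) ^ p := (g y).2
    rw [hgx] at h1
    have h2 : (fun z : L => ⁅z, y⁆)^[p] x = ((- LieAlgebra.ad F L y) ^ p) x := by
      rw [Module.End.pow_apply]
      congr 1
      congr 1
      funext z
      simp
    have h3 : (-1 : F) ^ p = -1 := neg_one_pow_expChar F p
    have h4 : (- LieAlgebra.ad F L y) = (-1 : F) • LieAlgebra.ad F L y := by simp
    rw [h2, h4, smul_pow, h3, ← h1]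
    simp
  · intro x y
    rw [sum_sFormula F L p hp2]
    simp only [map_add]
    change (g x).1.a + (g y).1.a + jacS F p (g x).1.x (g y).1.x = _
    rw [hgx, hgx]
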